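/- Let P be an r-differential poset. Over any field R of characteristic 0, the operator DU_n : RP_n → RP_n is invertible, the up map U_n : RP_n → RP_{n+1} is injective, and the down map D_{n+1} : RP_{n+1} → RP_n is surjective, for every n ≥ 0. Moreover, over ℤ, the maps U_n : ℤP_n → ℤP_{n+1} and DU_n : ℤP_n → ℤP_n are injective. -/

import Mathlib

open Polynomial

/-- A rectangular matrix over a commutative ring has Smith normal form: there are
invertible matrices `P`, `Q` such that `P * A * Q` is diagonal with diagonal entries
forming a divisibility chain. -/
def Matrix.HasSNF {R : Type*} [CommRing R] {m n : ℕ} (A : Matrix (Fin m) (Fin n) R) : Prop :=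
  ∃ (P : Matrix (Fin m) (Fin m) R) (Q : Matrix (Fin n) (Fin n) R),
    IsUnit P ∧ IsUnit Q ∧
    (∀ (i : Fin m) (j : Fin n), (i : ℕ) ≠ (j : ℕ) → (P * A * Q) i j = 0) ∧
    (∀ (i : ℕ) (h₁ : i + 1 < m) (h₂ : i + 1 < n),
      (P * A * Q) ⟨i, Nat.lt_of_succ_lt h₁⟩ ⟨i, Nat.lt_of_succ_lt h₂⟩ ∣
        (P * A * Q) ⟨i + 1, h₁⟩ ⟨i + 1, h₂⟩)

/-- SNF for matrices with arbitrary finite index types. -/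
def Matrix.HasSNF' {ι κ R : Type*} [Fintype ι] [Fintype κ] [CommRing R]
    (A : Matrix ι κ R) : Prop :=
  ∃ (eι : ι ≃ Fin (Fintype.card ι)) (eκ : κ ≃ Fin (Fintype.card κ)),
    Matrix.HasSNF (Matrix.reindex eι eκ A)
/-- An endomorphism `φ` of a `ℤ`-module `M` (equivalently, the `ℤ[x]`-module `(M, φ)` where
`x` acts as `φ`) has rational canonical form over `ℤ`: `M` is an internal direct sum of
cyclic `ℤ[x]`-submodules whose annihilators are generated by monic non-constant polynomials
`a_1 ∣ a_2 ∣ ... ∣ a_k`. -/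
def Module.End.HasRCF {M : Type*} [AddCommGroup M] [Module ℤ M] (φ : Module.End ℤ M) : Prop :=
  ∃ (k : ℕ) (V : Fin k → Submodule ℤ[X] (Module.AEval' φ)) (a : Fin k → ℤ[X]),
    (∀ i, (a i).Monic) ∧ (∀ i, 0 < (a i).natDegree) ∧
    (∀ i j : Fin k, i ≤ j → a i ∣ a j) ∧
    (∀ i, ∃ v : Module.AEval' φ, V i = Submodule.span ℤ[X] {v}) ∧
    (∀ i, (V i).annihilator = Ideal.span {a i}) ∧
    DirectSum.IsInternal V
/-- An `r`-differential poset. -/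
structure DiffPoset (r : ℕ) where
  P : Type
  [po : PartialOrder P]
  locallyFinite : ∀ x y : P, (Set.Icc x y).Finite
  rk : P → ℕ
  fiberFinite : ∀ n : ℕ, {x : P | rk x = n}.Finite
  bot : P
  bot_le : ∀ x : P, bot ≤ x
  rk_bot : rk bot = 0
  rk_covBy : ∀ {x y : P}, x ⋖ y → rk y = rk x + 1
  d2 : ∀ {x y : P}, x ≠ y →
      {z : P | z ⋖ x ∧ z ⋖ y}.ncard = {z : P | x ⋖ z ∧ y ⋖ z}.ncard
  d3 : ∀ x : P, {z : P | x ⋖ z}.ncard = {z : P | z ⋖ x}.ncard + r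

attribute [instance] DiffPoset.po

namespace DiffPoset

variable {r : ℕ} (D : DiffPoset r)

/-- The `n`-th rank `P_n` of the poset. -/
abbrev level (n : ℕ) : Type := {x : D.P // D.rk x = n}

noncomputable instance (n : ℕ) : Fintype (D.level n) := (D.fiberFinite n).fintype

noncomputable instance (n : ℕ) : DecidableEq (D.level n) := Classical.decEq _

noncomputable instance (x y : D.P) : Decidable (x ⋖ y) := Classical.dec _

/-- The rank size `p_n`. -/
noncomputable def p (n : ℕ) : ℕ := Fintype.card (D.level n)

/-- The matrix of the up map `U_n` in the standard basis. -/
noncomputable def upMatrix (R : Type*) [CommRing R] (n : ℕ) :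
    Matrix (D.level (n + 1)) (D.level n) R :=
  fun y x => if (x : D.P) ⋖ (y : D.P) then 1 else 0

/-- The matrix of the down map `D_{n+1}` in the standard basis. -/
noncomputable def downMatrix (R : Type*) [CommRing R] (n : ℕ) :
    Matrix (D.level n) (D.level (n + 1)) R :=
  fun y x => if (y : D.P) ⋖ (x : D.P) then 1 else 0

/-- The up map `U_n : RP_n → RP_{n+1}`. -/
noncomputable def up (R : Type*) [CommRing R] (n : ℕ) :
    (D.level n → R) →ₗ[R] (D.level (n + 1) → R) :=
  (D.upMatrix R n).mulVecLin

/-- The down map `D_{n+1} : RP_{n+1} → RP_n`. -/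
noncomputable def down (R : Type*) [CommRing R] (n : ℕ) :
    (D.level (n + 1) → R) →ₗ[R] (D.level n → R) :=
  (D.downMatrix R n).mulVecLin

/-- The operator `DU_n = D_{n+1} ∘ U_n`. -/
noncomputable def du (R : Type*) [CommRing R] (n : ℕ) :
    Module.End R (D.level n → R) :=
  (D.down R n) ∘ₗ (D.up R n)

/-- The matrix `[DU_n]` in the standard basis. -/
noncomputable def duMatrix (R : Type*) [CommRing R] (n : ℕ) :
    Matrix (D.level n) (D.level n) R :=
  D.downMatrix R n * D.upMatrix R n

/-- The operator `UD_n = U_{n-1} ∘ D_n` (zero for `n = 0`). -/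
noncomputable def ud (R : Type*) [CommRing R] : (n : ℕ) → Module.End R (D.level n → R)
  | 0 => 0
  | (n + 1) => (D.up R n) ∘ₗ (D.down R n)

/-- The matrix `[UD_n]` in the standard basis (zero for `n = 0`). -/
noncomputable def udMatrix (R : Type*) [CommRing R] :
    (n : ℕ) → Matrix (D.level n) (D.level n) R
  | 0 => 0
  | (n + 1) => D.upMatrix R n * D.downMatrix R n

/-- The rank size difference `Δp_n = p_n - p_{n-1}` (with `p_{-1} = 0`), as an integer. -/
noncomputable def dp : ℕ → ℤ
  | 0 => (D.p 0 : ℤ)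
  | (n + 1) => (D.p (n + 1) : ℤ) - (D.p n : ℤ)

/-- The rank size difference `Δp_n = p_n - p_{n-1}` (with `p_{-1} = 0`), as a natural number. -/
noncomputable def dpN : ℕ → ℕ
  | 0 => D.p 0
  | (n + 1) => D.p (n + 1) - D.p n

end DiffPoset

namespace DiffPoset

variable {r : ℕ} (D : DiffPoset r)

theorem duMatrix_apply (R : Type*) [CommRing R] {n : ℕ} (x y : D.level n) :
    D.duMatrix R n x y = ({z : D.P | (x : D.P) ⋖ z ∧ (y : D.P) ⋖ z}.ncard : R) := by
  have himage : {z : D.P | (x : D.P) ⋖ z ∧ (y : D.P) ⋖ z} =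
      Subtype.val '' {z : D.level (n + 1) | (x : D.P) ⋖ z ∧ (y : D.P) ⋖ z} := by
    ext z
    constructor
    · exact fun h => ⟨⟨z, by rw [D.rk_covBy h.1, x.2]⟩, h, rfl⟩
    · rintro ⟨z, h, rfl⟩
      exact h
  rw [himage, Set.ncard_image_of_injective _ Subtype.val_injective, Set.ncard_eq_toFinset_card']
  simp [duMatrix, Matrix.mul_apply, downMatrix, upMatrix, ← ite_and, and_comm]

theorem udMatrix_apply (R : Type*) [CommRing R] {n : ℕ} (x y : D.level n) :
    D.udMatrix R n x y = ({z : D.P | z ⋖ (x : D.P) ∧ z ⋖ (y : D.P)}.ncard : R) := by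
  cases n with
  | zero =>
    have hempty : {z : D.P | z ⋖ (x : D.P) ∧ z ⋖ (y : D.P)} = ∅ := by
      refine Set.eq_empty_of_forall_notMem fun z hz => ?_
      have := D.rk_covBy hz.1
      have := x.2
      omega
    simp [hempty, udMatrix]
  | succ n =>
    have himage : {z : D.P | z ⋖ (x : D.P) ∧ z ⋖ (y : D.P)} =
        Subtype.val '' {z : D.level n | (z : D.P) ⋖ x ∧ (z : D.P) ⋖ y} := by
      ext z
      constructor
      · intro h
        have := D.rk_covBy h.1
        have := x.2
        exact ⟨⟨z, by omega⟩, h, rfl⟩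
      · rintro ⟨z, h, rfl⟩
        exact h
    rw [himage, Set.ncard_image_of_injective _ Subtype.val_injective,
      Set.ncard_eq_toFinset_card']
    simp [udMatrix, Matrix.mul_apply, downMatrix, upMatrix, ← ite_and, and_comm]

/-- The commutation relation `DU - UD = rI`. -/
theorem duMatrix_eq_udMatrix_add (R : Type*) [CommRing R] (n : ℕ) :
    D.duMatrix R n = D.udMatrix R n + (r : R) • 1 := by
  ext x y
  rw [Matrix.add_apply, duMatrix_apply, udMatrix_apply]
  obtain rfl | hxy := eq_or_ne x y
  · simp [D.d3]
  · simp [D.d2 (Subtype.coe_ne_coe.mpr hxy), hxy]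

theorem upMatrix_transpose (R : Type*) [CommRing R] (n : ℕ) :
    (D.upMatrix R n).transpose = D.downMatrix R n := rfl

theorem dotProduct_udMatrix_mulVec_nonneg {n : ℕ} (v : D.level n → ℤ) :
    0 ≤ v ⬝ᵥ (D.udMatrix ℤ n).mulVec v := by
  cases n with
  | zero => simp [udMatrix]
  | succ n =>
    rw [udMatrix, ← Matrix.mulVec_mulVec, Matrix.dotProduct_mulVec, ← Matrix.mulVec_transpose,
      upMatrix_transpose]
    exact Finset.sum_nonneg fun i _ => mul_self_nonneg _

theorem det_duMatrix_int_ne_zero (hr : 0 < r) (n : ℕ) : (D.duMatrix ℤ n).det ≠ 0 := by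
  intro hdet
  obtain ⟨v, hv, h⟩ := Matrix.exists_mulVec_eq_zero_iff.mpr hdet
  have hform := congrArg (v ⬝ᵥ ·) h
  simp only [duMatrix_eq_udMatrix_add, Matrix.add_mulVec, Matrix.smul_mulVec,
    Matrix.one_mulVec, dotProduct_add, dotProduct_smul, dotProduct_zero, smul_eq_mul] at hform
  have hpos : 0 < v ⬝ᵥ v :=
    lt_of_le_of_ne (Finset.sum_nonneg fun i _ => mul_self_nonneg _)
      (Ne.symm (mt dotProduct_self_eq_zero.mp hv))
  have := D.dotProduct_udMatrix_mulVec_nonneg v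
  have : 0 < (r : ℤ) * (v ⬝ᵥ v) := mul_pos (by exact_mod_cast hr) hpos
  linarith

theorem duMatrix_map_intCast (R : Type*) [CommRing R] (n : ℕ) :
    (D.duMatrix ℤ n).map (Int.castRingHom R) = D.duMatrix R n := by
  ext x y
  simp [duMatrix_apply]

theorem det_duMatrix_ne_zero (hr : 0 < r) (R : Type*) [CommRing R] [CharZero R] (n : ℕ) :
    (D.duMatrix R n).det ≠ 0 := by
  rw [← duMatrix_map_intCast, ← RingHom.mapMatrix_apply, ← RingHom.map_det]
  simpa using D.det_duMatrix_int_ne_zero hr n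

theorem du_eq_mulVecLin (R : Type*) [CommRing R] (n : ℕ) :
    D.du R n = (D.duMatrix R n).mulVecLin :=
  (Matrix.mulVecLin_mul _ _).symm

theorem du_injective (hr : 0 < r) (R : Type*) [CommRing R] [IsDomain R] [CharZero R] (n : ℕ) :
    Function.Injective (D.du R n) := by
  rw [du_eq_mulVecLin, injective_iff_map_eq_zero]
  exact fun v hv => Matrix.eq_zero_of_mulVec_eq_zero (D.det_duMatrix_ne_zero hr R n) hv

theorem up_injective (hr : 0 < r) (R : Type*) [CommRing R] [IsDomain R] [CharZero R] (n : ℕ) :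
    Function.Injective (D.up R n) :=
  Function.Injective.of_comp (f := D.down R n) (D.du_injective hr R n)

theorem du_bijective (hr : 0 < r) (R : Type*) [Field R] [CharZero R] (n : ℕ) :
    Function.Bijective (D.du R n) :=
  ⟨D.du_injective hr R n, LinearMap.injective_iff_surjective.mp (D.du_injective hr R n)⟩

theorem down_surjective (hr : 0 < r) (R : Type*) [Field R] [CharZero R] (n : ℕ) :
    Function.Surjective (D.down R n) :=
  Function.Surjective.of_comp (g := D.up R n) (D.du_bijective hr R n).2

end DiffPoset

/-- For an `r`-differential poset: over any field `R` of characteristic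
zero, `DU_n` is invertible, `U_n` is injective and `D_{n+1}` is surjective for every `n ≥ 0`;
moreover over `ℤ` the maps `U_n` and `DU_n` are injective. -/
theorem du_invertible_up_injective_down_surjective {r : ℕ} (hr : 0 < r) (D : DiffPoset r) :
    (∀ (R : Type) [Field R] [CharZero R] (n : ℕ),
      Function.Bijective (D.du R n) ∧ Function.Injective (D.up R n) ∧
        Function.Surjective (D.down R n)) ∧
    (∀ n : ℕ, Function.Injective (D.up ℤ n) ∧ Function.Injective (D.du ℤ n)) :=
  ⟨fun R _ _ n => ⟨D.du_bijective hr R n, D.up_injective hr R n, D.down_surjective hr R n⟩,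
    fun n => ⟨D.up_injective hr ℤ n, D.du_injective hr ℤ n⟩⟩
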